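/- arXiv:0804.3421 — 2 statements merged into one kernel-verified Lean document; each statement's English description precedes it below -/
import Mathlib

section
/- (Superadditivity of the joint-decoding receiver cooperation game.) For any two disjoint coalitions S₁, S₂ ⊆ {1,…,K}, the coalition values satisfy v(S₁ ∪ S₂) ≥ v(S₁) + v(S₂), where v(S) = log det(N_S + Σ_{k∈S} P_k c_k(S) c_k(S)†) − log det(N_S). -/
open Matrix

/-- Interference-plus-noise covariance `N_S = I + ∑_{k∉S} P_k c_k(S) c_k(S)†` at the
receivers of coalition `S`, where `c_k(S) = (H_{m,k})_{m∈S}`. -/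
noncomputable def noiseCov {K : ℕ} (H : Matrix (Fin K) (Fin K) ℂ) (P : Fin K → ℝ)
    (S : Finset (Fin K)) : Matrix ↥S ↥S ℂ :=
  1 + ∑ k ∈ Sᶜ, (P k : ℂ) • vecMulVec (fun m : ↥S => H m.1 k) (star fun m : ↥S => H m.1 k)

/-- Signal covariance `∑_{k∈S} P_k c_k(S) c_k(S)†` of coalition `S`. -/
noncomputable def sigCov {K : ℕ} (H : Matrix (Fin K) (Fin K) ℂ) (P : Fin K → ℝ)
    (S : Finset (Fin K)) : Matrix ↥S ↥S ℂ :=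
  ∑ k ∈ S, (P k : ℂ) • vecMulVec (fun m : ↥S => H m.1 k) (star fun m : ↥S => H m.1 k)

/-- Value of a coalition of jointly decoding receivers:
`v(S) = log det(N_S + ∑_{k∈S} P_k c_k c_k†) − log det N_S`. -/
noncomputable def rxValue {K : ℕ} (H : Matrix (Fin K) (Fin K) ℂ) (P : Fin K → ℝ)
    (S : Finset (Fin K)) : ℝ :=
  Real.log ((noiseCov H P S + sigCov H P S).det.re) - Real.log ((noiseCov H P S).det.re)

open scoped ComplexOrder

/-- Schur complements on both sides of `[[M, Bᴴ], [B, N⁻¹]]`. -/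
lemma Matrix.PosDef.inv_sub_mul_inv_mul_posSemidef {m n : Type*} [Fintype m] [Fintype n]
    [DecidableEq m] [DecidableEq n] {M : Matrix n n ℂ} {N : Matrix m m ℂ}
    {B : Matrix m n ℂ} (hM : M.PosDef) (hN : N.PosDef) (h : (M - Bᴴ * N * B).PosSemidef) :
    (N⁻¹ - B * M⁻¹ * Bᴴ).PosSemidef := by
  have := hM.isUnit.invertible
  have := hN.inv.isUnit.invertible
  have h₁ := Matrix.PosDef.fromBlocks₁₁ Bᴴ N⁻¹ hM
  have h₂ := Matrix.PosDef.fromBlocks₂₂ M Bᴴ hN.inv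
  rw [conjTranspose_conjTranspose] at h₁ h₂
  rw [← h₁, h₂, nonsing_inv_nonsing_inv _ ((isUnit_iff_isUnit_det _).1 hN.isUnit)]
  exact h

lemma Matrix.det_add_smul_vecMulVec_star {n : Type*} [Fintype n] [DecidableEq n]
    {N : Matrix n n ℂ} (hN : N.PosDef) (p : ℂ) (c : n → ℂ) :
    (N + p • vecMulVec c (star c)).det = N.det * (1 + p * (star c ⬝ᵥ N⁻¹ *ᵥ c)) := by
  have hu := (isUnit_iff_isUnit_det _).1 hN.isUnit
  rw [← smul_vecMulVec, vecMulVec_eq Unit, det_add_replicateCol_mul_replicateRow hu,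
    det_unique (n := Unit), Matrix.mul_assoc, ← replicateCol_mulVec, mulVec_smul, ← smul_eq_mul p,
    ← dotProduct_smul]
  rfl

/-- Covariance of the received vector when the users in `T` transmit, the columns of `C` being
the channel vectors. -/
noncomputable def rxCov {n ι : Type*} [DecidableEq n] (C : Matrix n ι ℂ) (P : ι → ℝ)
    (T : Finset ι) : Matrix n n ℂ :=
  1 + ∑ k ∈ T, (P k : ℂ) • vecMulVec (fun i => C i k) (star fun i => C i k)

section rxCov

variable {m n ι : Type*} {P : ι → ℝ}

lemma posSemidef_sum_smul_vecMulVec [Fintype n] (C : Matrix n ι ℂ) (hP : ∀ k, 0 ≤ P k)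
    (T : Finset ι) :
    (∑ k ∈ T, (P k : ℂ) • vecMulVec (fun i => C i k) (star fun i => C i k)).PosSemidef :=
  posSemidef_sum _ fun k _ =>
    (posSemidef_vecMulVec_self_star _).smul (Complex.zero_le_real.2 (hP k))

variable [DecidableEq m] [DecidableEq n]

lemma rxCov_insert [DecidableEq ι] (C : Matrix n ι ℂ) {T : Finset ι} {k : ι} (hk : k ∉ T) :
    rxCov C P (insert k T) =
      rxCov C P T + (P k : ℂ) • vecMulVec (fun i => C i k) (star fun i => C i k) := by
  rw [rxCov, rxCov, Finset.sum_insert hk]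
  abel

lemma rxCov_submatrix (C : Matrix m ι ℂ) (T : Finset ι) {e : n → m} (he : e.Injective) :
    rxCov (C.submatrix e id) P T = (rxCov C P T).submatrix e e := by
  ext i j
  simp [rxCov, Matrix.sum_apply, one_apply, he.eq_iff, vecMulVec_apply]

variable [Fintype n]

lemma rxCov_posDef (C : Matrix n ι ℂ) (hP : ∀ k, 0 ≤ P k) (T : Finset ι) :
    (rxCov C P T).PosDef :=
  PosDef.one.add_posSemidef (posSemidef_sum_smul_vecMulVec C hP T)

lemma rxCov_submatrix_sub_posSemidef [DecidableEq ι] (C : Matrix m ι ℂ) (hP : ∀ k, 0 ≤ P k)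
    {T T' : Finset ι} (hT : T ⊆ T') {e : n → m} (he : e.Injective) :
    (rxCov (C.submatrix e id) P T' - (rxCov C P T).submatrix e e).PosSemidef := by
  rw [← rxCov_submatrix C T he, rxCov, rxCov, ← Finset.sum_sdiff hT, add_sub_add_left_eq_sub,
    add_sub_cancel_right]
  exact posSemidef_sum_smul_vecMulVec _ hP _

variable [Fintype m]

lemma rxCov_inv_dotProduct_le [DecidableEq ι] (C : Matrix m ι ℂ) (hP : ∀ k, 0 ≤ P k)
    {T T' : Finset ι} (hT : T ⊆ T') {e : n → m} (he : e.Injective) (c : m → ℂ) :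
    star (c ∘ e) ⬝ᵥ (rxCov (C.submatrix e id) P T')⁻¹ *ᵥ (c ∘ e) ≤
      star c ⬝ᵥ (rxCov C P T)⁻¹ *ᵥ c := by
  set B : Matrix m n ℂ := (1 : Matrix m m ℂ).submatrix id e with hB
  have hBN : Bᴴ * rxCov C P T * B = (rxCov C P T).submatrix e e := by
    ext i j
    simp [hB, mul_apply, one_apply, apply_ite]
  have hBc : Bᴴ *ᵥ c = c ∘ e := by
    ext i
    simp [hB, mulVec, dotProduct, one_apply, apply_ite]
  have hBc' : star (c ∘ e) = star c ᵥ* B := by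
    rw [← hBc, star_mulVec, conjTranspose_conjTranspose]
  have h := ((rxCov_posDef (C.submatrix e id) hP T').inv_sub_mul_inv_mul_posSemidef
    (rxCov_posDef C hP T) (B := B)
    (hBN ▸ rxCov_submatrix_sub_posSemidef C hP hT he)).dotProduct_mulVec_nonneg c
  rw [sub_mulVec, dotProduct_sub, sub_nonneg, ← mulVec_mulVec, hBc, ← mulVec_mulVec,
    dotProduct_mulVec, ← hBc'] at h
  exact h

/-- Log-determinant of the received covariance. -/
noncomputable def rxLogDet (C : Matrix n ι ℂ) (P : ι → ℝ) (T : Finset ι) : ℝ :=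
  Real.log (rxCov C P T).det.re

lemma rxLogDet_insert [DecidableEq ι] (C : Matrix n ι ℂ) (hP : ∀ k, 0 ≤ P k)
    {T : Finset ι} {k : ι} (hk : k ∉ T) :
    rxLogDet C P (insert k T) = rxLogDet C P T + Real.log (1 + P k *
      (star (fun i => C i k) ⬝ᵥ (rxCov C P T)⁻¹ *ᵥ fun i => C i k).re) := by
  have hN := rxCov_posDef C hP T
  have hd := Complex.pos_iff.1 hN.det_pos
  have hq := Complex.nonneg_iff.1
    (hN.inv.posSemidef.dotProduct_mulVec_nonneg fun i => C i k)
  rw [rxLogDet, rxLogDet, rxCov_insert C hk, det_add_smul_vecMulVec_star hN,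
    ← Real.log_mul hd.1.ne' (by have := mul_nonneg (hP k) hq.1; positivity)]
  simp [← hd.2]

lemma rxLogDet_union_sub_le [DecidableEq ι] (C : Matrix m ι ℂ) (hP : ∀ k, 0 ≤ P k)
    {T T' : Finset ι} (hT : T ⊆ T') {e : n → m} (he : e.Injective) {U : Finset ι}
    (hU : Disjoint U T') :
    rxLogDet (C.submatrix e id) P (U ∪ T') - rxLogDet (C.submatrix e id) P T' ≤
      rxLogDet C P (U ∪ T) - rxLogDet C P T := by
  induction U using Finset.induction_on with
  | empty => simp
  | insert k U hk ih =>
    rw [Finset.disjoint_insert_left] at hU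
    have hk' : k ∉ U ∪ T' := by simp [hk, hU.1]
    have hsub : U ∪ T ⊆ U ∪ T' := Finset.union_subset_union_right hT
    rw [Finset.insert_union, Finset.insert_union, rxLogDet_insert _ hP hk',
      rxLogDet_insert _ hP fun h => hk' (hsub h)]
    have hle := (Complex.le_def.1
      (rxCov_inv_dotProduct_le C hP hsub he fun i => C i k)).1
    have hq := (Complex.nonneg_iff.1 ((rxCov_posDef (C.submatrix e id) hP
      (U ∪ T')).inv.posSemidef.dotProduct_mulVec_nonneg fun i => C (e i) k)).1
    have hlog := Real.log_le_log (by have := mul_nonneg (hP k) hq; positivity)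
      (add_le_add_right (mul_le_mul_of_nonneg_left hle (hP k)) 1)
    have := ih hU.2
    simp only [submatrix_apply, id_eq, Function.comp_def] at hlog ⊢
    linarith

end rxCov

lemma rxValue_eq_rxLogDet_sub {K : ℕ} (H : Matrix (Fin K) (Fin K) ℂ) (P : Fin K → ℝ)
    (S : Finset (Fin K)) :
    rxValue H P S = rxLogDet (H.submatrix (Subtype.val : S → Fin K) id) P (S ∪ Sᶜ) -
      rxLogDet (H.submatrix (Subtype.val : S → Fin K) id) P Sᶜ := by
  have h : noiseCov H P S + sigCov H P S =
      rxCov (H.submatrix (Subtype.val : S → Fin K) id) P (S ∪ Sᶜ) := by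
    rw [noiseCov, sigCov, rxCov, Finset.sum_union disjoint_compl_right, add_assoc]
    exact congrArg _ (add_comm _ _)
  rw [rxValue, h]
  rfl

/-- Superadditivity of the joint-decoding receiver cooperation game:
for disjoint coalitions `S₁`, `S₂`, `v(S₁ ∪ S₂) ≥ v(S₁) + v(S₂)`. -/
theorem rx_value_superadditive {K : ℕ} (H : Matrix (Fin K) (Fin K) ℂ)
    (P : Fin K → ℝ) (hP : ∀ k, 0 < P k)
    (S₁ S₂ : Finset (Fin K)) (hdisj : Disjoint S₁ S₂) :
    rxValue H P (S₁ ∪ S₂) ≥ rxValue H P S₁ + rxValue H P S₂ := by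
  have hP' : ∀ k, 0 ≤ P k := fun k => (hP k).le
  let e₁ : S₁ → ↥(S₁ ∪ S₂) := Set.inclusion Finset.subset_union_left
  let e₂ : S₂ → ↥(S₁ ∪ S₂) := Set.inclusion Finset.subset_union_right
  have h₁ := rxLogDet_union_sub_le (H.submatrix (Subtype.val : ↥(S₁ ∪ S₂) → Fin K) id) hP'
    (subset_refl S₁ᶜ) (e := e₁) (Set.inclusion_injective _) disjoint_compl_right
  have h₂ := rxLogDet_union_sub_le (H.submatrix (Subtype.val : ↥(S₁ ∪ S₂) → Fin K) id) hP'
    (Finset.compl_subset_compl.2 (Finset.subset_union_right : S₂ ⊆ S₁ ∪ S₂))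
    (e := e₂) (Set.inclusion_injective _) disjoint_compl_right
  have hS : S₂ ∪ (S₁ ∪ S₂)ᶜ = S₁ᶜ := by
    ext k
    have : k ∈ S₁ → k ∉ S₂ := fun h => Finset.disjoint_left.1 hdisj h
    simp only [Finset.mem_union, Finset.mem_compl]
    tauto
  rw [hS] at h₂
  rw [submatrix_submatrix] at h₁ h₂
  rw [rxValue_eq_rxLogDet_sub, rxValue_eq_rxLogDet_sub, rxValue_eq_rxLogDet_sub,
    Finset.union_compl, Finset.union_compl, Finset.union_compl]
  rw [Finset.union_compl] at h₁ h₂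
  change rxLogDet (H.submatrix (Subtype.val : S₁ → Fin K) id) P _ -
    rxLogDet (H.submatrix (Subtype.val : S₁ → Fin K) id) P _ ≤ _ at h₁
  change rxLogDet (H.submatrix (Subtype.val : S₂ → Fin K) id) P _ -
    rxLogDet (H.submatrix (Subtype.val : S₂ → Fin K) id) P _ ≤ _ at h₂
  linarith
end

section
/- (Saddle point of the transmitter cooperation jamming game.) Fix a coalition S ⊆ {1,…,K} and let l(Q₁, Q₂) = log det(I_K + H_S Q₁ H_S† + H_{Sᶜ} Q₂ H_{Sᶜ}†) − log det(I_K + H_{Sᶜ} Q₂ H_{Sᶜ}†) for Q₁ ∈ C(S) and Q₂ ∈ C(Sᶜ). Then there exist Q₁* ∈ C(S) and Q₂* ∈ C(Sᶜ) such that l(Q₁, Q₂*) ≤ l(Q₁*, Q₂*) ≤ l(Q₁*, Q₂) for all Q₁ ∈ C(S) and Q₂ ∈ C(Sᶜ); consequently, max_{Q₁∈C(S)} min_{Q₂∈C(Sᶜ)} l(Q₁,Q₂) = min_{Q₂∈C(Sᶜ)} max_{Q₁∈C(S)} l(Q₁,Q₂). -/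
open Matrix ComplexOrder

/-- Admissible covariance set
`C(T) = {Q Hermitian PSD : Q_{kk} ≤ P_k for all k ∈ T}` for the users in `T`. -/
def covSet {K : ℕ} (P : Fin K → ℝ) (T : Finset (Fin K)) :
    Set (Matrix ↥T ↥T ℂ) :=
  {Q | Q.PosSemidef ∧ ∀ k : ↥T, Q k k ≤ (P k.1 : ℂ)}

/-- Payoff of the transmitter cooperation jamming game for coalition `S`:
`l(Q₁,Q₂) = log det(I_K + H_S Q₁ H_S† + H_{Sᶜ} Q₂ H_{Sᶜ}†)
          − log det(I_K + H_{Sᶜ} Q₂ H_{Sᶜ}†)`,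
where `H_T` is the submatrix of the columns of `H` indexed by `T`. -/
noncomputable def jamPayoff {K : ℕ} (H : Matrix (Fin K) (Fin K) ℂ)
    (S : Finset (Fin K)) (Q₁ : Matrix ↥S ↥S ℂ) (Q₂ : Matrix ↥Sᶜ ↥Sᶜ ℂ) : ℝ :=
  let HS : Matrix (Fin K) ↥S ℂ := Matrix.of fun i k => H i k.1
  let HSc : Matrix (Fin K) ↥Sᶜ ℂ := Matrix.of fun i k => H i k.1
  Real.log ((1 + HS * Q₁ * HSᴴ + HSc * Q₂ * HScᴴ).det.re)
    - Real.log ((1 + HSc * Q₂ * HScᴴ).det.re)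

open scoped MatrixOrder in
/-- A positive definite matrix and a Hermitian matrix are simultaneously diagonalized by a
congruence; this is the resulting formula for the determinants of their combinations. -/
theorem Matrix.PosDef.exists_det_smul_add_smul {n : Type*} [Fintype n] [DecidableEq n]
    {A D : Matrix n n ℂ} (hA : A.PosDef) (hD : D.IsHermitian) :
    ∃ (c : ℝ) (d : n → ℝ), 0 < c ∧
      (∀ s t : ℝ, (s • A + t • D).det.re = c * ∏ i, (s + t * d i)) ∧
      (D.PosSemidef → ∀ i, 0 ≤ d i) ∧ (D.PosDef → ∀ i, 0 < d i) := by
  obtain ⟨B, hB⟩ := CStarAlgebra.nonneg_iff_eq_star_mul_self.mp hA.posSemidef.nonneg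
  rw [star_eq_conjTranspose] at hB
  have hdet : A.det = star B.det * B.det := by rw [hB, det_mul, det_conjTranspose]
  have hBu : IsUnit B := by
    rw [isUnit_iff_isUnit_det, isUnit_iff_ne_zero]
    intro h
    exact hA.det_pos.ne' (by simp [hdet, h])
  have hBd : IsUnit B.det := (isUnit_iff_isUnit_det B).mp hBu
  have hBdH : IsUnit Bᴴ.det := by rw [det_conjTranspose]; exact hBd.star
  set E := (B⁻¹)ᴴ * D * B⁻¹ with hE
  have hEh : E.IsHermitian := isHermitian_conjTranspose_mul_mul _ hD
  have hDE : D = Bᴴ * E * B := by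
    rw [hE, conjTranspose_nonsing_inv]
    simp only [Matrix.mul_assoc]
    rw [nonsing_inv_mul _ hBd, ← Matrix.mul_assoc, mul_nonsing_inv _ hBdH]
    simp
  have hinv : IsUnit B⁻¹ := by
    rw [isUnit_iff_isUnit_det]
    exact isUnit_nonsing_inv_det _ hBd
  refine ⟨Complex.normSq B.det, hEh.eigenvalues, Complex.normSq_pos.mpr hBd.ne_zero, ?_, ?_, ?_⟩
  · intro s t
    have h1 : s • A + t • D = Bᴴ * (s • (1 : Matrix n n ℂ) + t • E) * B := by
      rw [hB, hDE]
      simp [Matrix.mul_add, Matrix.add_mul]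
    set U : Matrix n n ℂ := (hEh.eigenvectorUnitary : Matrix n n ℂ) with hU
    have hUU : U * star U = 1 := Unitary.coe_mul_star_self hEh.eigenvectorUnitary
    have hspec : E = U * diagonal (RCLike.ofReal ∘ hEh.eigenvalues) * star U := by
      conv_lhs => rw [hEh.spectral_theorem]
      rw [Unitary.conjStarAlgAut_apply]
    have h2 : s • (1 : Matrix n n ℂ) + t • E =
        U * diagonal (fun i => ((s + t * hEh.eigenvalues i : ℝ) : ℂ)) * star U := by
      have h3 : diagonal (fun i => ((s + t * hEh.eigenvalues i : ℝ) : ℂ)) =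
          s • (1 : Matrix n n ℂ) + t • diagonal (RCLike.ofReal ∘ hEh.eigenvalues) := by
        ext i j
        by_cases hij : i = j
        · subst hij; simp
        · simp [hij]
      rw [h3, Matrix.mul_add, Matrix.add_mul]
      conv_lhs => rw [hspec]
      simp [hUU]
    have hUd : U.det * (star U).det = 1 := by rw [← det_mul, hUU, det_one]
    have h4 : (s • A + t • D).det =
        ((Complex.normSq B.det * ∏ i, (s + t * hEh.eigenvalues i) : ℝ) : ℂ) := by
      rw [h1, h2]
      simp only [det_mul, det_diagonal, det_conjTranspose]
      rw [Complex.ofReal_mul, Complex.ofReal_prod, Complex.normSq_eq_conj_mul_self,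
        starRingEnd_apply]
      linear_combination (star B.det * B.det *
        ∏ i, ((s + t * hEh.eigenvalues i : ℝ) : ℂ)) * hUd
    rw [h4, Complex.ofReal_re]
  · intro h
    exact (h.conjTranspose_mul_mul_same B⁻¹).eigenvalues_nonneg
  · intro h
    exact (h.conjTranspose_mul_mul_same
      (mulVec_injective_iff_isUnit.mpr hinv)).eigenvalues_pos

theorem Matrix.PosDef.det_re_pos {n : Type*} [Fintype n] [DecidableEq n]
    {A : Matrix n n ℂ} (hA : A.PosDef) : 0 < A.det.re :=
  (Complex.pos_iff.mp hA.det_pos).1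

theorem Matrix.convex_setOf_posSemidef (n : Type*) : Convex ℝ {A : Matrix n n ℂ | A.PosSemidef} :=
  fun _ hA _ hB _ _ ha hb _ => (hA.smul ha).add (hB.smul hb)

theorem Matrix.convex_setOf_posDef (n : Type*) : Convex ℝ {A : Matrix n n ℂ | A.PosDef} := by
  intro A hA B hB a b ha hb hab
  rcases ha.eq_or_lt with rfl | ha
  · obtain rfl : b = 1 := by linarith
    simpa using hB
  · exact (PosDef.smul hA ha).add_posSemidef (hB.posSemidef.smul hb)

/-- `log det` is monotone on positive definite matrices for the Loewner order. -/
theorem Matrix.PosDef.log_det_le_add {n : Type*} [Fintype n] [DecidableEq n]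
    {A D : Matrix n n ℂ} (hA : A.PosDef) (hD : D.PosSemidef) :
    Real.log A.det.re ≤ Real.log (A + D).det.re := by
  obtain ⟨c, d, hc, hdet, hd, -⟩ := hA.exists_det_smul_add_smul hD.isHermitian
  have h0 := hdet 1 0
  have h1 := hdet 1 1
  simp only [one_smul, zero_smul, add_zero, one_mul, zero_mul, Finset.prod_const_one,
    mul_one] at h0 h1
  refine Real.log_le_log hA.det_re_pos ?_
  rw [h0, h1]
  have : (1 : ℝ) ≤ ∏ i, (1 + d i) :=
    Finset.prod_induction _ (1 ≤ ·) (fun _ _ => one_le_mul_of_one_le_of_one_le) le_rfl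
      fun i _ => by linarith [hd hD i]
  nlinarith

theorem Matrix.concaveOn_log_det (n : Type*) [Fintype n] [DecidableEq n] :
    ConcaveOn ℝ {A : Matrix n n ℂ | A.PosDef} fun A => Real.log A.det.re := by
  refine ⟨convex_setOf_posDef n, ?_⟩
  intro A hA B hB a b ha hb hab
  obtain ⟨c, d, hc, hdet, -, hd⟩ := PosDef.exists_det_smul_add_smul hA hB.isHermitian
  replace hd := hd hB
  have h0 := hdet 1 0
  have h1 := hdet 0 1
  simp only [one_smul, zero_smul, add_zero, zero_add, one_mul, zero_mul, Finset.prod_const_one,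
    mul_one] at h0 h1
  have hpos : ∀ i, 0 < a + b * d i := fun i => by
    rcases ha.eq_or_lt with rfl | ha
    · obtain rfl : b = 1 := by linarith
      simpa using hd i
    · have := mul_nonneg hb (hd i).le
      linarith
  simp only [smul_eq_mul]
  rw [h0, h1, hdet a b, Real.log_mul hc.ne' (Finset.prod_pos fun i _ => hd i).ne',
    Real.log_mul hc.ne' (Finset.prod_pos fun i _ => hpos i).ne',
    Real.log_prod fun i _ => (hd i).ne', Real.log_prod fun i _ => (hpos i).ne']
  have key : ∑ i, b * Real.log (d i) ≤ ∑ i, Real.log (a + b * d i) := by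
    refine Finset.sum_le_sum fun i _ => ?_
    have := strictConcaveOn_log_Ioi.concaveOn.2 (Set.mem_Ioi.mpr one_pos)
      (Set.mem_Ioi.mpr (hd i)) ha hb hab
    simpa using this
  rw [← Finset.mul_sum] at key
  have : a * Real.log c + b * Real.log c = Real.log c := by rw [← add_mul, hab, one_mul]
  linarith

section SchurComplement

variable {n : Type*} [Fintype n] [DecidableEq n] {N C : Matrix n n ℂ}

omit [DecidableEq n] in
theorem Matrix.PosDef.add_mul_conjTranspose_self (hN : N.PosDef) (C : Matrix n n ℂ) :
    (N + C * Cᴴ).PosDef :=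
  hN.add_posSemidef (posSemidef_self_mul_conjTranspose C)

theorem Matrix.PosDef.det_one_sub_conjTranspose_mul_inv_mul (hN : N.PosDef) (C : Matrix n n ℂ) :
    (1 - Cᴴ * (N + C * Cᴴ)⁻¹ * C).det = N.det / (N + C * Cᴴ).det := by
  have hY := hN.add_mul_conjTranspose_self C
  have hu := (isUnit_iff_isUnit_det _).mp hY.isUnit
  rw [eq_div_iff hY.det_pos.ne', Matrix.mul_assoc, det_one_sub_mul_comm, mul_comm, ← det_mul,
    Matrix.mul_sub, Matrix.mul_one, Matrix.mul_assoc, mul_nonsing_inv_cancel_left _ _ hu,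
    add_sub_cancel_right]

theorem Matrix.PosDef.one_sub_conjTranspose_mul_inv_mul (hN : N.PosDef) (C : Matrix n n ℂ) :
    (1 - Cᴴ * (N + C * Cᴴ)⁻¹ * C).PosDef := by
  have hY := hN.add_mul_conjTranspose_self C
  have := hY.isUnit.invertible
  have h : (fromBlocks (N + C * Cᴴ) C Cᴴ (1 : Matrix n n ℂ)).PosSemidef := by
    have : Invertible (1 : Matrix n n ℂ) := invertibleOne
    rw [PosDef.fromBlocks₂₂ _ _ PosDef.one]
    simpa using hN.posSemidef
  rw [PosDef.fromBlocks₁₁ _ _ hY] at h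
  rw [h.posDef_iff_det_ne_zero, hN.det_one_sub_conjTranspose_mul_inv_mul]
  exact div_ne_zero hN.det_pos.ne' hY.det_pos.ne'

/-- Operator convexity of `Y ↦ Cᴴ Y⁻¹ C` on positive definite matrices. -/
theorem Matrix.PosDef.posSemidef_conjTranspose_mul_inv_mul_convex {Y₁ Y₂ : Matrix n n ℂ}
    (h₁ : Y₁.PosDef) (h₂ : Y₂.PosDef) (C : Matrix n n ℂ) {a b : ℝ} (ha : 0 ≤ a) (hb : 0 ≤ b)
    (hab : a + b = 1) :
    (a • (Cᴴ * Y₁⁻¹ * C) + b • (Cᴴ * Y₂⁻¹ * C) - Cᴴ * (a • Y₁ + b • Y₂)⁻¹ * C).PosSemidef := by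
  have hblock : ∀ {Y : Matrix n n ℂ}, Y.PosDef →
      (fromBlocks Y C Cᴴ (Cᴴ * Y⁻¹ * C)).PosSemidef := fun {Y} hY => by
    have := hY.isUnit.invertible
    rw [PosDef.fromBlocks₁₁ _ _ hY, sub_self]
    exact PosSemidef.zero
  have h := convex_setOf_posSemidef _ (hblock h₁) (hblock h₂) ha hb hab
  have hY : (a • Y₁ + b • Y₂).PosDef := convex_setOf_posDef _ h₁ h₂ ha hb hab
  have := hY.isUnit.invertible
  rw [Set.mem_ofPred_eq, fromBlocks_smul, fromBlocks_smul, fromBlocks_add, ← add_smul, ← add_smul,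
    hab, one_smul, one_smul, PosDef.fromBlocks₁₁ _ _ hY] at h
  exact h

open scoped MatrixOrder in
theorem Matrix.PosSemidef.convexOn_log_det_add_sub_log_det {X : Matrix n n ℂ}
    (hX : X.PosSemidef) :
    ConvexOn ℝ {N : Matrix n n ℂ | N.PosDef}
      fun N => Real.log (N + X).det.re - Real.log N.det.re := by
  obtain ⟨B, hB⟩ := CStarAlgebra.nonneg_iff_eq_star_mul_self.mp hX.nonneg
  obtain ⟨C, rfl⟩ : ∃ C : Matrix n n ℂ, X = C * Cᴴ := ⟨Bᴴ, by simpa [star_eq_conjTranspose] using hB⟩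
  have hlog : ∀ {N : Matrix n n ℂ}, N.PosDef →
      Real.log (N + C * Cᴴ).det.re - Real.log N.det.re =
        -Real.log (1 - Cᴴ * (N + C * Cᴴ)⁻¹ * C).det.re := fun {N} hN => by
    have hY := hN.add_mul_conjTranspose_self C
    have hZ := hN.one_sub_conjTranspose_mul_inv_mul C
    have h := hN.det_one_sub_conjTranspose_mul_inv_mul C
    rw [eq_div_iff hY.det_pos.ne'] at h
    have hre := congrArg Complex.re h
    rw [Complex.mul_re, ← (Complex.pos_iff.mp hY.det_pos).2, mul_zero, sub_zero] at hre
    rw [← hre, Real.log_mul hZ.det_re_pos.ne' hY.det_re_pos.ne']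
    ring
  refine ⟨convex_setOf_posDef n, ?_⟩
  intro N₁ h₁ N₂ h₂ a b ha hb hab
  have hN := convex_setOf_posDef n h₁ h₂ ha hb hab
  have hZ₁ := PosDef.one_sub_conjTranspose_mul_inv_mul h₁ C
  have hZ₂ := PosDef.one_sub_conjTranspose_mul_inv_mul h₂ C
  have hcomb : a • (N₁ + C * Cᴴ) + b • (N₂ + C * Cᴴ) = a • N₁ + b • N₂ + C * Cᴴ := by
    rw [smul_add, smul_add, add_add_add_comm, ← add_smul, hab, one_smul]
  have hD := PosDef.posSemidef_conjTranspose_mul_inv_mul_convex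
    (PosDef.add_mul_conjTranspose_self h₁ C)
    (PosDef.add_mul_conjTranspose_self h₂ C) C ha hb hab
  rw [hcomb] at hD
  have hconc := (concaveOn_log_det n).2 hZ₁ hZ₂ ha hb hab
  have hmono := PosDef.log_det_le_add (convex_setOf_posDef n hZ₁ hZ₂ ha hb hab) hD
  have hsum : ∀ W₁ W₂ W : Matrix n n ℂ,
      a • (1 - W₁) + b • (1 - W₂) + (a • W₁ + b • W₂ - W) = 1 - W := fun W₁ W₂ W => by
    have h1 : a • (1 : Matrix n n ℂ) + b • (1 : Matrix n n ℂ) = 1 := by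
      rw [← add_smul, hab, one_smul]
    rw [smul_sub, smul_sub]
    nth_rewrite 3 [← h1]
    abel
  rw [hsum] at hmono
  simp only [smul_eq_mul] at hconc ⊢
  rw [hlog hN, hlog h₁, hlog h₂]
  linarith

end SchurComplement

section Covariance

variable {K : ℕ} (P : Fin K → ℝ) (T : Finset (Fin K))

theorem covSet_nonempty (hP : ∀ k, 0 < P k) : (covSet P T).Nonempty :=
  ⟨0, PosSemidef.zero, fun k => by simpa using (hP k.1).le⟩

theorem convex_covSet : Convex ℝ (covSet P T) := by
  intro A hA B hB a b ha hb hab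
  refine ⟨convex_setOf_posSemidef _ hA.1 hB.1 ha hb hab, fun k => ?_⟩
  have h1 := Complex.le_def.mp (hA.2 k)
  have h2 := Complex.le_def.mp (hB.2 k)
  simp only [Complex.ofReal_re, Complex.ofReal_im] at h1 h2
  rw [Complex.le_def]
  simp only [Matrix.add_apply, Matrix.smul_apply, Complex.add_re, Complex.add_im,
    Complex.smul_re, Complex.smul_im, Complex.ofReal_re, Complex.ofReal_im, smul_eq_mul,
    h1.2, h2.2, mul_zero, add_zero, and_true]
  calc a * (A k k).re + b * (B k k).re ≤ a * P k.1 + b * P k.1 :=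
        add_le_add (mul_le_mul_of_nonneg_left h1.1 ha) (mul_le_mul_of_nonneg_left h2.1 hb)
    _ = P k.1 := by rw [← add_mul, hab, one_mul]

theorem Matrix.isClosed_setOf_posSemidef (n : Type*) [Fintype n] :
    IsClosed {A : Matrix n n ℂ | A.PosSemidef} := by
  simp only [posSemidef_iff_dotProduct_mulVec, Set.ofPred_and, Set.ofPred_forall]
  refine IsClosed.inter (isClosed_eq (by fun_prop) continuous_id) (isClosed_iInter fun x => ?_)
  exact isClosed_le continuous_const (by fun_prop)

theorem Matrix.PosSemidef.norm_apply_sq_le {n : Type*} {A : Matrix n n ℂ} (hA : A.PosSemidef)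
    (i j : n) : ‖A i j‖ ^ 2 ≤ (A i i).re * (A j j).re := by
  have h := (hA.submatrix ![i, j]).det_nonneg
  rw [det_fin_two] at h
  simp only [submatrix_apply, cons_val_zero, cons_val_one] at h
  have h1 := (Complex.le_def.mp h).1
  have hi := (Complex.nonneg_iff.mp (hA.diag_nonneg (i := i))).2
  rw [← hA.isHermitian.apply j i, Complex.sub_re, Complex.mul_re, ← hi, zero_mul, sub_zero,
    Complex.star_def, Complex.mul_conj, Complex.ofReal_re, Complex.normSq_eq_norm_sq,
    Complex.zero_re] at h1
  linarith

theorem isCompact_covSet : IsCompact (covSet P T) := by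
  have hcpt : IsCompact (Set.univ.pi fun i : ↥T => Set.univ.pi fun j : ↥T =>
      Metric.closedBall (0 : ℂ) (|P i.1| + |P j.1|)) :=
    isCompact_univ_pi fun i => isCompact_univ_pi fun j => isCompact_closedBall _ _
  refine hcpt.of_isClosed_subset ?_ ?_
  · have : covSet P T = {A | A.PosSemidef} ∩ ⋂ k : ↥T, {A | A k k ≤ (P k.1 : ℂ)} := by
      ext A
      simp [covSet]
    rw [this]
    exact (isClosed_setOf_posSemidef _).inter
      (isClosed_iInter fun k => isClosed_le (by fun_prop) continuous_const)
  · intro A hA i _ j _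
    rw [mem_closedBall_zero_iff]
    have hdiag : ∀ k : ↥T, 0 ≤ (A k k).re ∧ (A k k).re ≤ |P k.1| := fun k =>
      ⟨(Complex.nonneg_iff.mp hA.1.diag_nonneg).1,
        le_trans (by simpa using (Complex.le_def.mp (hA.2 k)).1) (le_abs_self _)⟩
    have h := hA.1.norm_apply_sq_le i j
    refine abs_le_of_sq_le_sq' ?_ (by positivity) |>.2
    have hi := hdiag i
    have hj := hdiag j
    have := mul_le_mul hi.2 hj.2 hj.1 (abs_nonneg _)
    nlinarith [sq_nonneg |P i.1|, sq_nonneg |P j.1|, mul_nonneg (abs_nonneg (P i.1))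
      (abs_nonneg (P j.1))]

end Covariance

section Payoff

variable {m n₁ n₂ : Type*} [Fintype m] [DecidableEq m] [Fintype n₁] [Fintype n₂]

omit [Fintype m] in
theorem Matrix.PosSemidef.one_add_mul_mul_conjTranspose_posDef [Finite m]
    {Q : Matrix n₁ n₁ ℂ} (hQ : Q.PosSemidef) (G : Matrix m n₁ ℂ) :
    (1 + G * Q * Gᴴ).PosDef :=
  PosDef.one.add_posSemidef (hQ.mul_mul_conjTranspose_same G)

theorem Matrix.PosSemidef.one_add_add_posDef {Q₁ : Matrix n₁ n₁ ℂ} {Q₂ : Matrix n₂ n₂ ℂ}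
    (h₁ : Q₁.PosSemidef) (h₂ : Q₂.PosSemidef) (G₁ : Matrix m n₁ ℂ) (G₂ : Matrix m n₂ ℂ) :
    (1 + G₁ * Q₁ * G₁ᴴ + G₂ * Q₂ * G₂ᴴ).PosDef :=
  (h₁.one_add_mul_mul_conjTranspose_posDef G₁).add_posSemidef (h₂.mul_mul_conjTranspose_same G₂)

omit [Fintype m] [DecidableEq m] in
theorem Matrix.add_mul_convexComb_mul_conjTranspose (G : Matrix m n₁ ℂ) (A B : Matrix n₁ n₁ ℂ)
    {a b : ℝ} (hab : a + b = 1) (M : Matrix m m ℂ) :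
    M + G * (a • A + b • B) * Gᴴ = a • (M + G * A * Gᴴ) + b • (M + G * B * Gᴴ) := by
  rw [smul_add, smul_add, add_add_add_comm, ← add_smul, hab, one_smul]
  simp [Matrix.mul_add, Matrix.add_mul]

variable {K : ℕ} (H : Matrix (Fin K) (Fin K) ℂ) (P : Fin K → ℝ) (S : Finset (Fin K))

theorem concaveOn_jamPayoff {Q₂ : Matrix ↥Sᶜ ↥Sᶜ ℂ} (h₂ : Q₂.PosSemidef) :
    ConcaveOn ℝ (covSet P S) fun Q₁ => jamPayoff H S Q₁ Q₂ := by
  refine ⟨convex_covSet P S, ?_⟩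
  intro A hA B hB a b ha hb hab
  simp only [jamPayoff, smul_eq_mul]
  set G₁ : Matrix (Fin K) ↥S ℂ := Matrix.of fun i k => H i k.1
  set G₂ : Matrix (Fin K) ↥Sᶜ ℂ := Matrix.of fun i k => H i k.1
  have h := (concaveOn_log_det (Fin K)).2 (hA.1.one_add_add_posDef h₂ G₁ G₂)
    (hB.1.one_add_add_posDef h₂ G₁ G₂) ha hb hab
  have hcomb := add_mul_convexComb_mul_conjTranspose G₁ A B hab (1 + G₂ * Q₂ * G₂ᴴ)
  simp only [add_right_comm _ (G₂ * Q₂ * G₂ᴴ)] at hcomb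
  rw [← hcomb] at h
  simp only [smul_eq_mul] at h
  have hc : ∀ r : ℝ, a * r + b * r = r := fun r => by rw [← add_mul, hab, one_mul]
  linarith [hc (Real.log (1 + G₂ * Q₂ * G₂ᴴ).det.re)]

theorem convexOn_jamPayoff {Q₁ : Matrix ↥S ↥S ℂ} (h₁ : Q₁.PosSemidef) :
    ConvexOn ℝ (covSet P Sᶜ) fun Q₂ => jamPayoff H S Q₁ Q₂ := by
  refine ⟨convex_covSet P Sᶜ, ?_⟩
  intro A hA B hB a b ha hb hab
  simp only [jamPayoff]
  set G₁ : Matrix (Fin K) ↥S ℂ := Matrix.of fun i k => H i k.1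
  set G₂ : Matrix (Fin K) ↥Sᶜ ℂ := Matrix.of fun i k => H i k.1
  have h := (h₁.mul_mul_conjTranspose_same G₁).convexOn_log_det_add_sub_log_det.2
    (hA.1.one_add_mul_mul_conjTranspose_posDef G₂)
    (hB.1.one_add_mul_mul_conjTranspose_posDef G₂) ha hb hab
  rw [← add_mul_convexComb_mul_conjTranspose G₂ A B hab] at h
  simpa only [add_right_comm _ _ (G₁ * Q₁ * G₁ᴴ)] using h

theorem continuousOn_jamPayoff :
    ContinuousOn (fun Q : Matrix ↥S ↥S ℂ × Matrix ↥Sᶜ ↥Sᶜ ℂ => jamPayoff H S Q.1 Q.2)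
      (covSet P S ×ˢ covSet P Sᶜ) := by
  simp only [jamPayoff]
  have hG : ∀ (G : Matrix (Fin K) ↥Sᶜ ℂ), Continuous
      fun Q : Matrix ↥S ↥S ℂ × Matrix ↥Sᶜ ↥Sᶜ ℂ => G * Q.2 * Gᴴ := fun G =>
    (continuous_const.matrix_mul continuous_snd).matrix_mul continuous_const
  have hF : ∀ (G : Matrix (Fin K) ↥S ℂ), Continuous
      fun Q : Matrix ↥S ↥S ℂ × Matrix ↥Sᶜ ↥Sᶜ ℂ => 1 + G * Q.1 * Gᴴ := fun G =>
    continuous_const.add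
      ((continuous_const.matrix_mul continuous_fst).matrix_mul continuous_const)
  refine (ContinuousOn.log ?_ ?_).sub (ContinuousOn.log ?_ ?_)
  · exact (Complex.continuous_re.comp ((hF _).add (hG _)).matrix_det).continuousOn
  · exact fun Q hQ => (hQ.1.1.one_add_add_posDef hQ.2.1 _ _).det_re_pos.ne'
  · exact (Complex.continuous_re.comp (continuous_const.add (hG _)).matrix_det).continuousOn
  · exact fun Q hQ => (hQ.2.1.one_add_mul_mul_conjTranspose_posDef _).det_re_pos.ne'

end Payoff

/-- At a saddle point the lower and the upper value of a game with bounded payoffs agree. -/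
theorem iSup_iInf_eq_iInf_iSup_of_saddle {α β : Type*} {f : α → β → ℝ}
    (hbelow : ∀ x, BddBelow (Set.range (f x))) (habove : ∀ y, BddAbove (Set.range fun x => f x y))
    {a : α} {b : β} (h₁ : ∀ x, f x b ≤ f a b) (h₂ : ∀ y, f a b ≤ f a y) :
    ⨆ x, ⨅ y, f x y = ⨅ y, ⨆ x, f x y := by
  have : Nonempty α := ⟨a⟩
  have : Nonempty β := ⟨b⟩
  have hlow : ∀ x, ⨅ y, f x y ≤ f a b := fun x => (ciInf_le (hbelow x) b).trans (h₁ x)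
  have hupp : ∀ y, f a b ≤ ⨆ x, f x y := fun y => (h₂ y).trans (le_ciSup (habove y) a)
  refine le_antisymm ((ciSup_le hlow).trans (le_ciInf hupp)) ?_
  calc ⨅ y, ⨆ x, f x y ≤ ⨆ x, f x b :=
        ciInf_le ⟨f a b, Set.forall_mem_range.mpr hupp⟩ b
    _ ≤ f a b := ciSup_le h₁
    _ ≤ ⨅ y, f a y := le_ciInf h₂
    _ ≤ ⨆ x, ⨅ y, f x y := le_ciSup (f := fun x => ⨅ y, f x y)
        ⟨f a b, Set.forall_mem_range.mpr hlow⟩ a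

/-- Saddle-point property of the transmitter cooperation jamming game: there exist
admissible `Q₁* ∈ C(S)`, `Q₂* ∈ C(Sᶜ)` with
`l(Q₁,Q₂*) ≤ l(Q₁*,Q₂*) ≤ l(Q₁*,Q₂)` for all admissible `Q₁`, `Q₂`; consequently
`max_{Q₁} min_{Q₂} l = min_{Q₂} max_{Q₁} l`. -/
theorem jamming_game_saddle_point {K : ℕ} (H : Matrix (Fin K) (Fin K) ℂ)
    (P : Fin K → ℝ) (hP : ∀ k, 0 < P k) (S : Finset (Fin K)) :
    ∃ Q₁ ∈ covSet P S, ∃ Q₂ ∈ covSet P Sᶜ,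
      (∀ Q₁' ∈ covSet P S, jamPayoff H S Q₁' Q₂ ≤ jamPayoff H S Q₁ Q₂) ∧
      (∀ Q₂' ∈ covSet P Sᶜ, jamPayoff H S Q₁ Q₂ ≤ jamPayoff H S Q₁ Q₂') ∧
      (⨆ Q₁' : covSet P S, ⨅ Q₂' : covSet P Sᶜ, jamPayoff H S Q₁' Q₂')
        = (⨅ Q₂' : covSet P Sᶜ, ⨆ Q₁' : covSet P S, jamPayoff H S Q₁' Q₂') := by
  have hcont := continuousOn_jamPayoff H P S
  have hc₁ : ∀ Q₂ ∈ covSet P Sᶜ, ContinuousOn (fun Q₁ => jamPayoff H S Q₁ Q₂) (covSet P S) :=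
    fun Q₂ h₂ => hcont.comp (f := fun Q₁ => (Q₁, Q₂)) (by fun_prop) fun Q₁ h₁ => ⟨h₁, h₂⟩
  have hc₂ : ∀ Q₁ ∈ covSet P S, ContinuousOn (fun Q₂ => jamPayoff H S Q₁ Q₂) (covSet P Sᶜ) :=
    fun Q₁ h₁ => hcont.comp (f := fun Q₂ => (Q₁, Q₂)) (by fun_prop) fun Q₂ h₂ => ⟨h₁, h₂⟩
  obtain ⟨Q₂, h₂, Q₁, h₁, hsaddle⟩ := Sion.exists_isSaddlePointOn
    (f := fun Q₂ Q₁ => jamPayoff H S Q₁ Q₂) (covSet_nonempty P Sᶜ hP) (convex_covSet P Sᶜ)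
    (isCompact_covSet P Sᶜ) (fun Q₁ h₁ => (hc₂ Q₁ h₁).lowerSemicontinuousOn)
    (fun Q₁ h₁ => (convexOn_jamPayoff H P S h₁.1).quasiconvexOn) (convex_covSet P S)
    (covSet_nonempty P S hP) (isCompact_covSet P S)
    (fun Q₂ h₂ => (hc₁ Q₂ h₂).upperSemicontinuousOn)
    (fun Q₂ h₂ => (concaveOn_jamPayoff H P S h₂.1).quasiconcaveOn)
  have hmax : ∀ Q₁' ∈ covSet P S, jamPayoff H S Q₁' Q₂ ≤ jamPayoff H S Q₁ Q₂ :=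
    fun Q₁' h => hsaddle Q₂ h₂ Q₁' h
  have hmin : ∀ Q₂' ∈ covSet P Sᶜ, jamPayoff H S Q₁ Q₂ ≤ jamPayoff H S Q₁ Q₂' :=
    fun Q₂' h => hsaddle Q₂' h Q₁ h₁
  refine ⟨Q₁, h₁, Q₂, h₂, hmax, hmin, ?_⟩
  refine iSup_iInf_eq_iInf_iSup_of_saddle
    (f := fun (Q₁' : covSet P S) (Q₂' : covSet P Sᶜ) => jamPayoff H S Q₁' Q₂')
    (fun Q₁' => ?_) (fun Q₂' => ?_) (a := ⟨Q₁, h₁⟩) (b := ⟨Q₂, h₂⟩)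
    (fun Q₁' => hmax Q₁' Q₁'.2) (fun Q₂' => hmin Q₂' Q₂'.2)
  · simpa only [Set.image_eq_range] using (isCompact_covSet P Sᶜ).bddBelow_image (hc₂ Q₁' Q₁'.2)
  · simpa only [Set.image_eq_range] using (isCompact_covSet P S).bddAbove_image (hc₁ Q₂' Q₂'.2)
end
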